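/- arXiv:2602.19167 — 5 statements merged into one kernel-verified Lean document; each statement's English description precedes it below -/
import Mathlib

section
/- Let n be a natural number and let f, g : Fin n → ℝ both be sorted in non-ascending order (i.e., antitone: i ≤ j implies f j ≤ f i, and likewise for g). Then for every permutation σ of Fin n, ∑_{i} max(f i − g i, 0) ≤ ∑_{i} max(f i − g(σ i), 0). (ND lower bound computation: pairing the query vertex's sorted list of neighbor edge weights with the candidate vertex's sorted list of neighbor edge weights minimizes the summed positive-part difference over all possible neighbor matchings, so the sorted-pairing value is a lower bound of the neighbor difference ND.) -/
/-- ND lower bound computation: pairing two non-ascending sorted lists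
coordinatewise minimizes the summed positive-part difference over all
possible matchings. -/
theorem sorted_pairing_posPart_lowerBound (n : ℕ) (f g : Fin n → ℝ)
    (hf : Antitone f) (hg : Antitone g) (σ : Equiv.Perm (Fin n)) :
    ∑ i, max (f i - g i) 0 ≤ ∑ i, max (f i - g (σ i)) 0 := by
  induction n with
  | zero => simp
  | succ n ih =>
    obtain ⟨⟨p, e⟩, rfl⟩ := Equiv.Perm.decomposeFin.symm.surjective σ
    have key := ih (fun i => f i.succ) (fun i => g i.succ)
      (fun i j h => hf (Fin.succ_le_succ_iff.2 h)) (fun i j h => hg (Fin.succ_le_succ_iff.2 h)) e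
    rw [Fin.sum_univ_succ, Fin.sum_univ_succ]
    simp only [Equiv.Perm.decomposeFin_symm_apply_zero, Equiv.Perm.decomposeFin_symm_apply_succ]
    refine (add_le_add_right key _).trans ?_
    rcases Fin.eq_zero_or_eq_succ p with rfl | ⟨q, rfl⟩
    · simp
    · have h : ∑ x, (max (f (Fin.succ x) - g (e x).succ) 0 +
          if x = e.symm q then max (f 0 - g 0) 0 - max (f 0 - g q.succ) 0 else 0) ≤
          ∑ x, max (f (Fin.succ x) - g (Equiv.swap 0 q.succ (e x).succ)) 0 := by
        refine Finset.sum_le_sum fun x _ => ?_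
        split_ifs with hx
        · subst hx
          simp only [Equiv.apply_symm_apply, Equiv.swap_apply_right]
          have h1 := hf (Fin.zero_le (e.symm q).succ)
          have h2 := hg (Fin.zero_le q.succ)
          generalize f (e.symm q).succ = a at *
          grind
        · have hne : (e x).succ ≠ q.succ := by
            intro hc
            apply hx
            rw [← Fin.succ_injective _ hc]
            simp
          rw [Equiv.swap_apply_of_ne_of_ne (Fin.succ_ne_zero _) hne]
          simp
      rw [Finset.sum_add_distrib, Finset.sum_ite_eq' Finset.univ] at h
      simp only [Finset.mem_univ, if_true] at h
      linarith
end

section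
/- Let n be a natural number and let f, g : Fin n → ℝ both be sorted in non-ascending order (i.e., antitone: i ≤ j implies f j ≤ f i, and likewise for g). Then for every permutation σ of Fin n, ∑_{i} min(f i, g(σ i)) ≤ ∑_{i} min(f i, g i). (Sorted pairing maximizes the sum of pairwise minima over all matchings; this is the ordered-optimality claim in the proof of the ND lower bound.) -/
/-- Sorted pairing maximizes the sum of pairwise minima over all matchings. -/
theorem sorted_pairing_min_upperBound (n : ℕ) (f g : Fin n → ℝ)
    (hf : Antitone f) (hg : Antitone g) (σ : Equiv.Perm (Fin n)) :
    ∑ i, min (f i) (g (σ i)) ≤ ∑ i, min (f i) (g i) := by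
  induction n with
  | zero => simp
  | succ n ih =>
    obtain ⟨⟨p, e⟩, rfl⟩ := Equiv.Perm.decomposeFin.symm.surjective σ
    have key := ih (fun i => f i.succ) (fun i => g i.succ)
      (fun i j h => hf (Fin.succ_le_succ_iff.mpr h))
      (fun i j h => hg (Fin.succ_le_succ_iff.mpr h)) e
    rw [Fin.sum_univ_succ, Fin.sum_univ_succ (fun i => min (f i) (g i))]
    simp only [Equiv.Perm.decomposeFin_symm_apply_zero, Equiv.Perm.decomposeFin_symm_apply_succ]
    induction p using Fin.cases with
    | zero => simpa using key
    | succ q =>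
      refine le_trans ?_ (add_le_add_right key _)
      rw [← Finset.add_sum_erase _ _ (Finset.mem_univ (e.symm q)),
        ← Finset.add_sum_erase (a := e.symm q) _ (fun i => min (f i.succ) (g (e i).succ))
          (Finset.mem_univ _)]
      have h1 : ∑ x ∈ Finset.univ.erase (e.symm q),
          min (f x.succ) (g (Equiv.swap 0 q.succ (e x).succ)) =
          ∑ x ∈ Finset.univ.erase (e.symm q), min (f x.succ) (g (e x).succ) := by
        refine Finset.sum_congr rfl fun x hx => ?_
        rw [Equiv.swap_apply_of_ne_of_ne (Fin.succ_ne_zero _)]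
        intro h
        apply Finset.ne_of_mem_erase hx
        rw [← Fin.succ_injective _ h]; simp
      rw [h1]
      simp only [Equiv.apply_symm_apply, Equiv.swap_apply_right]
      have a := hf (Fin.zero_le (e.symm q).succ)
      have b := hg (Fin.zero_le q.succ)
      have c : min (f 0) (g q.succ) + min (f (e.symm q).succ) (g 0)
          ≤ min (f 0) (g 0) + min (f (e.symm q).succ) (g q.succ) := by
        grind
      linarith
end

section
/- Let n be a natural number, let f, g : Fin n → ℝ both be sorted in non-ascending order (antitone), and let δ be a real number. If δ < ∑_{i} max(f i − g i, 0), then for every permutation σ of Fin n, δ < ∑_{i} max(f i − g(σ i), 0). (Vertex-level ND lower bound pruning: if the sorted-difference lower bound of the neighbor difference between a query vertex and a candidate vertex exceeds the threshold δ, then the neighbor difference under every possible neighbor matching exceeds δ, so the candidate vertex can be safely pruned.) -/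
theorem nd_swap_aux (a b c d : ℝ) (hab : b ≤ a) (hcd : d ≤ c) :
    max (a - c) 0 + max (b - d) 0 ≤ max (a - d) 0 + max (b - c) 0 := by
  rcases max_cases (a - c) 0 with h1 | h1 <;> rcases max_cases (b - d) 0 with h2 | h2 <;>
  rcases max_cases (a - d) 0 with h3 | h3 <;> rcases max_cases (b - c) 0 with h4 | h4 <;>
  linarith

theorem nd_perm_aux (n : ℕ) : ∀ (f g : Fin n → ℝ) (_ : Antitone f) (_ : Antitone g)
    (σ : Equiv.Perm (Fin n)),
    ∑ i, max (f i - g i) 0 ≤ ∑ i, max (f i - g (σ i)) 0 := by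
  induction n with
  | zero => intro f g _ _ σ; simp
  | succ n ih =>
    intro f g hf hg σ
    obtain ⟨⟨p, e⟩, rfl⟩ := Equiv.Perm.decomposeFin.symm.surjective σ
    have h := ih (fun i => f i.succ) (fun i => g i.succ)
      (fun i j hij => hf (Fin.succ_le_succ_iff.2 hij))
      (fun i j hij => hg (Fin.succ_le_succ_iff.2 hij)) e
    rw [Fin.sum_univ_succ, Fin.sum_univ_succ]
    simp only [Equiv.Perm.decomposeFin_symm_apply_zero, Equiv.Perm.decomposeFin_symm_apply_succ]
    refine le_trans (add_le_add_right h _) ?_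
    induction p using Fin.cases with
    | zero => simp
    | succ q =>
      rw [← Finset.add_sum_erase _ _ (Finset.mem_univ (e.symm q)),
        ← Finset.add_sum_erase (a := e.symm q) Finset.univ
          (fun x => max (f x.succ - g (Equiv.swap 0 q.succ (e x).succ)) 0) (Finset.mem_univ _)]
      have hs : ∑ x ∈ Finset.univ.erase (e.symm q), max (f x.succ - g (e x).succ) 0
          = ∑ x ∈ Finset.univ.erase (e.symm q),
            max (f x.succ - g (Equiv.swap 0 q.succ (e x).succ)) 0 := by
        refine Finset.sum_congr rfl fun x hx => ?_
        rw [Equiv.swap_apply_of_ne_of_ne (Fin.succ_ne_zero _)]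
        intro hq
        have : e x = q := Fin.succ_injective _ hq
        exact (Finset.ne_of_mem_erase hx) (by simp [← this])
      rw [hs]
      simp only [Equiv.apply_symm_apply, Equiv.swap_apply_right]
      have := nd_swap_aux (f 0) (f (e.symm q).succ) (g 0) (g q.succ)
        (hf (Fin.zero_le _)) (hg (Fin.zero_le _))
      linarith

/-- Vertex-level ND lower bound pruning: if the sorted-difference lower bound
exceeds the threshold δ, then the neighbor difference under every possible
matching exceeds δ. -/
theorem nd_lowerBound_pruning (n : ℕ) (f g : Fin n → ℝ)
    (hf : Antitone f) (hg : Antitone g) (δ : ℝ)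
    (hδ : δ < ∑ i, max (f i - g i) 0) (σ : Equiv.Perm (Fin n)) :
    δ < ∑ i, max (f i - g (σ i)) 0 := by
  exact lt_of_lt_of_le hδ (nd_perm_aux n f g hf hg σ)
end

section
/- Let m and n be natural numbers, and let r, t : Fin m → Fin n → ℝ be such that for every j in Fin m, both r j and t j are sorted in non-ascending order (antitone). Then for every family of permutations σ_j of Fin n indexed by j in Fin m, ∑_{j} ∑_{i} max(r j i − t j i, 0) ≤ ∑_{j} ∑_{i} max(r j i − t j (σ_j i), 0). (GND lower bound computation for the SUM aggregate: summing the per-vertex sorted-difference lower bounds over all matching vertex pairs gives a lower bound of the generalized neighbor difference GND(q, g) under the SUM aggregation function, for any choice of neighbor matchings.) -/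
lemma exch (a b c d : ℝ) (h1 : b ≤ a) (h2 : d ≤ c) :
    max (a - c) 0 + max (b - d) 0 ≤ max (a - d) 0 + max (b - c) 0 := by
  rcases max_cases (a - c) 0 with h | h <;> rcases max_cases (b - d) 0 with h' | h' <;>
  rcases max_cases (a - d) 0 with h'' | h'' <;> rcases max_cases (b - c) 0 with h3 | h3 <;>
  linarith

lemma single (n : ℕ) : ∀ (f g : Fin n → ℝ), Antitone f → Antitone g →
    ∀ σ : Equiv.Perm (Fin n), ∑ i, max (f i - g i) 0 ≤ ∑ i, max (f i - g (σ i)) 0 := by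
  induction n with
  | zero => intros; simp
  | succ n ih =>
    intro f g hf hg σ
    obtain ⟨⟨p, e⟩, rfl⟩ := Equiv.Perm.decomposeFin.symm.surjective σ
    have key := ih (fun i => f i.succ) (fun i => g i.succ)
      (fun a b h => hf (Fin.succ_le_succ_iff.2 h)) (fun a b h => hg (Fin.succ_le_succ_iff.2 h)) e
    rw [Fin.sum_univ_succ, Fin.sum_univ_succ]
    simp only [Equiv.Perm.decomposeFin_symm_apply_zero, Equiv.Perm.decomposeFin_symm_apply_succ]
    refine (add_le_add_right key _).trans ?_
    rcases Fin.eq_zero_or_eq_succ p with rfl | ⟨q, rfl⟩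
    · simp
    · obtain ⟨y, rfl⟩ := e.surjective q
      rw [← Finset.add_sum_erase _ _ (Finset.mem_univ y),
        ← Finset.add_sum_erase Finset.univ
          (fun x => max (f x.succ - g (Equiv.swap 0 (e y).succ (e x).succ)) 0)
          (Finset.mem_univ y)]
      have h : ∑ x ∈ Finset.univ.erase y,
          max (f x.succ - g (Equiv.swap 0 (e y).succ (e x).succ)) 0 =
          ∑ x ∈ Finset.univ.erase y, max (f x.succ - g (e x).succ) 0 := by
        refine Finset.sum_congr rfl fun x hx => ?_
        rw [Equiv.swap_apply_of_ne_of_ne (Fin.succ_ne_zero _)]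
        intro h
        exact (Finset.mem_erase.1 hx).1 (e.injective (Fin.succ_injective _ h))
      rw [h, Equiv.swap_apply_right]
      have := exch (f 0) (f y.succ) (g 0) (g (e y).succ) (hf (Fin.zero_le _)) (hg (Fin.zero_le _))
      linarith


/-- GND lower bound computation for the SUM aggregate: summing the per-vertex
sorted-difference lower bounds gives a lower bound of the generalized neighbor
difference under SUM aggregation, for any choice of neighbor matchings. -/
theorem gnd_sum_lowerBound (m n : ℕ) (r t : Fin m → Fin n → ℝ)
    (hr : ∀ j, Antitone (r j)) (ht : ∀ j, Antitone (t j))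
    (σ : Fin m → Equiv.Perm (Fin n)) :
    ∑ j, ∑ i, max (r j i - t j i) 0 ≤ ∑ j, ∑ i, max (r j i - t j (σ j i)) 0 := by
  exact Finset.sum_le_sum fun j _ => single n (r j) (t j) (hr j) (ht j) (σ j)
end

section
/- Let n be a natural number, let f : Fin n → ℝ be sorted in non-ascending order (antitone), let g : Fin n → ℝ be arbitrary, and let τ be a permutation of Fin n such that g ∘ τ is sorted in non-ascending order (antitone). Then for every permutation σ of Fin n, ∑_{i} max(f i − g(τ i), 0) ≤ ∑_{i} max(f i − g(σ i), 0). (Full form of the ND lower bound: pairing the sorted query weight list with a non-ascending rearrangement of the candidate weight list yields a value no larger than the positive-part difference sum under any matching of the candidate weights to the query weights.) -/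
theorem monge_aux (n : ℕ) : ∀ (c : Fin n → Fin n → ℝ)
    (_ : ∀ i k j l, i ≤ k → j ≤ l → c i j + c k l ≤ c i l + c k j)
    (ρ : Equiv.Perm (Fin n)), ∑ i, c i i ≤ ∑ i, c i (ρ i) := by
  induction n with
  | zero => intro c _ ρ; simp
  | succ n ih =>
    intro c hc ρ
    obtain ⟨⟨p, e⟩, rfl⟩ := Equiv.Perm.decomposeFin.symm.surjective ρ
    rw [Fin.sum_univ_succ, Fin.sum_univ_succ]
    simp only [Equiv.Perm.decomposeFin_symm_apply_zero, Equiv.Perm.decomposeFin_symm_apply_succ]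
    have h1 := ih (fun i j => c i.succ j.succ)
      (fun i k j l h h' => hc _ _ _ _ (Fin.succ_le_succ_iff.2 h) (Fin.succ_le_succ_iff.2 h')) e
    induction p using Fin.cases with
    | zero => simpa using h1
    | succ q =>
      have h2 : ∑ i : Fin n, (c i.succ (e i).succ + if e i = q then c 0 0 - c 0 q.succ else 0)
          ≤ ∑ i : Fin n, c i.succ (Equiv.swap 0 q.succ (e i).succ) := by
        apply Finset.sum_le_sum
        intro i _
        by_cases h : e i = q
        · have := hc 0 i.succ 0 q.succ (Fin.zero_le _) (Fin.zero_le _)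
          simp only [h, if_true, Equiv.swap_apply_right]
          linarith
        · rw [Equiv.swap_apply_of_ne_of_ne (Fin.succ_ne_zero _)
            (fun h' => h (Fin.succ_injective _ h'))]
          simp [h]
      rw [Finset.sum_add_distrib,
        Equiv.sum_comp e (fun j => if j = q then c 0 0 - c 0 q.succ else 0)] at h2
      simp only [Finset.sum_ite_eq', Finset.mem_univ, if_true] at h2
      linarith

/-- Full form of the ND lower bound: pairing the sorted query weight list with
a non-ascending rearrangement of the candidate weight list yields a value no
larger than the positive-part difference sum under any matching. -/
theorem nd_lowerBound_full (n : ℕ) (f g : Fin n → ℝ) (hf : Antitone f)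
    (τ : Equiv.Perm (Fin n)) (hτ : Antitone (g ∘ τ)) (σ : Equiv.Perm (Fin n)) :
    ∑ i, max (f i - g (τ i)) 0 ≤ ∑ i, max (f i - g (σ i)) 0 := by
  have h := monge_aux n (fun i j => max (f i - g (τ j)) 0) (by
    intro i k j l hik hjl
    have h1 := hf hik
    have h2 : g (τ l) ≤ g (τ j) := hτ hjl
    rcases max_cases (f i - g (τ j)) 0 with h | h <;>
    rcases max_cases (f k - g (τ l)) 0 with h' | h' <;>
    rcases max_cases (f i - g (τ l)) 0 with h'' | h'' <;>
    rcases max_cases (f k - g (τ j)) 0 with h''' | h''' <;> linarith) (τ⁻¹ * σ)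
  simpa using h
end
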